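/- arXiv:2510.05370 — 3 statements merged into one kernel-verified Lean document; each statement's English description precedes it below -/
import Mathlib

section
/- Let x ∈ ℝᵈ with x ≠ 0 and let λ ≥ 0. Then the soft-threshold vector S(x, λ) = (1 − λ/‖x‖₂)₊ x is the unique global minimizer over δ ∈ ℝᵈ of the function δ ↦ (1/2)‖δ − x‖₂² + λ‖δ‖₂. -/
/-- The objective `δ ↦ (1/2)‖δ - x‖² + lam‖δ‖` grows at least quadratically away from the
soft-threshold vector. -/
theorem softThreshold_quadratic_growth {E : Type*} [NormedAddCommGroup E] [InnerProductSpace ℝ E]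
    {x : E} (hx : x ≠ 0) {lam : ℝ} (hlam : 0 ≤ lam) (δ : E) :
    (1/2) * ‖max (1 - lam / ‖x‖) 0 • x - x‖ ^ 2 + lam * ‖max (1 - lam / ‖x‖) 0 • x‖
        + (1/2) * ‖δ - max (1 - lam / ‖x‖) 0 • x‖ ^ 2
      ≤ (1/2) * ‖δ - x‖ ^ 2 + lam * ‖δ‖ := by
  have hn : 0 < ‖x‖ := norm_pos_iff.mpr hx
  have hcs : inner ℝ δ x ≤ ‖δ‖ * ‖x‖ := real_inner_le_norm δ x
  rcases le_total lam ‖x‖ with h | h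
  · have hc : 0 ≤ 1 - lam / ‖x‖ := sub_nonneg.mpr ((div_le_one hn).mpr h)
    rw [max_eq_left hc]
    obtain ⟨t, rfl⟩ : ∃ t, lam = t * ‖x‖ := ⟨lam / ‖x‖, (div_mul_cancel₀ _ hn.ne').symm⟩
    have ht : 0 ≤ t := nonneg_of_mul_nonneg_left hlam hn
    rw [mul_div_cancel_right₀ _ hn.ne'] at hc ⊢
    rw [norm_sub_sq_real, norm_sub_sq_real, norm_sub_sq_real, norm_smul, Real.norm_of_nonneg hc,
      real_inner_smul_left, real_inner_smul_right, real_inner_self_eq_norm_sq]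
    linarith [mul_le_mul_of_nonneg_left hcs ht]
  · rw [max_eq_right (sub_nonpos.mpr ((one_le_div hn).mpr h))]
    simp only [zero_smul, zero_sub, sub_zero, norm_neg, norm_zero, norm_sub_sq_real δ x]
    linarith [mul_le_mul_of_nonneg_right h (norm_nonneg δ)]

/-- For x ≠ 0 in ℝᵈ and λ ≥ 0, the soft-threshold vector
S(x, λ) = (1 − λ/‖x‖)₊ x is the unique global minimizer of
δ ↦ (1/2)‖δ − x‖₂² + λ‖δ‖₂. -/
theorem stmt9 {d : ℕ} (x : EuclideanSpace ℝ (Fin d)) (hx : x ≠ 0)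
    (lam : ℝ) (hlam : 0 ≤ lam) :
    let S : EuclideanSpace ℝ (Fin d) := max (1 - lam / ‖x‖) 0 • x
    (∀ δ : EuclideanSpace ℝ (Fin d),
      (1/2) * ‖S - x‖ ^ 2 + lam * ‖S‖ ≤ (1/2) * ‖δ - x‖ ^ 2 + lam * ‖δ‖) ∧
    (∀ δ : EuclideanSpace ℝ (Fin d),
      (1/2) * ‖δ - x‖ ^ 2 + lam * ‖δ‖ = (1/2) * ‖S - x‖ ^ 2 + lam * ‖S‖ → δ = S) := by
  intro S
  have key := softThreshold_quadratic_growth hx hlam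
  refine ⟨fun δ => ?_, fun δ h => ?_⟩
  · linarith [key δ, sq_nonneg ‖δ - S‖]
  · have hsq : ‖δ - S‖ ^ 2 ≤ 0 := by linarith [key δ]
    exact sub_eq_zero.mp (norm_eq_zero.mp (pow_eq_zero_iff two_ne_zero |>.mp
      (le_antisymm hsq (sq_nonneg _))))
end

section
/- Let d ≥ 1, let ρ > 0, γ > 0 with γρ > 1, and λ ≥ 0, and let P_γ(t, λ) denote the MCP. Let u ∈ ℝᵈ with ‖u‖₂ > γλ. Then δ = u is a global minimizer over δ ∈ ℝᵈ of the function f(δ) = (ρ/2)‖δ − u‖₂² + P_γ(‖δ‖₂, λ). -/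
/-- Outer branch of the MCP δ-update: if γρ > 1, λ ≥ 0 and ‖u‖₂ > γλ, then δ = u
is a global minimizer of δ ↦ (ρ/2)‖δ − u‖₂² + P_γ(‖δ‖₂, λ), where P_γ is the MCP. -/
theorem stmt10 {d : ℕ} (hd : 1 ≤ d) (ρ γ lam : ℝ)
    (hρ : 0 < ρ) (hγ : 0 < γ) (hγρ : 1 < γ * ρ) (hlam : 0 ≤ lam)
    (u : EuclideanSpace ℝ (Fin d)) (hu : γ * lam < ‖u‖) :
    let P : ℝ → ℝ := fun t =>
      if t ≤ γ * lam then lam * t - t ^ 2 / (2 * γ) else γ * lam ^ 2 / 2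
    let f : EuclideanSpace ℝ (Fin d) → ℝ := fun δ => (ρ / 2) * ‖δ - u‖ ^ 2 + P ‖δ‖
    ∀ δ : EuclideanSpace ℝ (Fin d), f u ≤ f δ := by
  intro P f δ
  have hfu : f u = γ * lam ^ 2 / 2 := by simp [f, P, not_le.mpr hu]
  rw [hfu]
  by_cases hδ : ‖δ‖ ≤ γ * lam
  · have hfδ : f δ = ρ / 2 * ‖δ - u‖ ^ 2 + (lam * ‖δ‖ - ‖δ‖ ^ 2 / (2 * γ)) := by
      simp [f, P, hδ]
    have hdist : γ * lam - ‖δ‖ ≤ ‖δ - u‖ := by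
      linarith [norm_sub_norm_le u δ, norm_sub_rev u δ]
    have hsq : (γ * lam - ‖δ‖) ^ 2 ≤ ‖δ - u‖ ^ 2 :=
      pow_le_pow_left₀ (sub_nonneg.mpr hδ) hdist 2
    have hgap : γ * lam ^ 2 / 2 - (lam * ‖δ‖ - ‖δ‖ ^ 2 / (2 * γ))
        = 1 / γ / 2 * (γ * lam - ‖δ‖) ^ 2 := by
      field_simp
      ring
    have hinv : 1 / γ ≤ ρ := by
      rw [div_le_iff₀ hγ]
      linarith
    have hle : 1 / γ / 2 * (γ * lam - ‖δ‖) ^ 2 ≤ ρ / 2 * ‖δ - u‖ ^ 2 := by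
      gcongr
    linarith
  · have hfδ : f δ = ρ / 2 * ‖δ - u‖ ^ 2 + γ * lam ^ 2 / 2 := by simp [f, P, hδ]
    have hnonneg : 0 ≤ ρ / 2 * ‖δ - u‖ ^ 2 := by positivity
    linarith
end

section
/- Let d ≥ 1, let ρ > 0, γ > 0 with γρ > 1, and λ ≥ 0, and let P_γ(t, λ) denote the MCP. Let u ∈ ℝᵈ with 0 < ‖u‖₂ ≤ γλ. Then δ* = S(u, λ/ρ) / (1 − 1/(γρ)) is a global minimizer over δ ∈ ℝᵈ of the function f(δ) = (ρ/2)‖δ − u‖₂² + P_γ(‖δ‖₂, λ); explicitly, δ* = 0 if ‖u‖₂ ≤ λ/ρ and δ* = (1 − λ/(ρ‖u‖₂)) u / (1 − 1/(γρ)) if ‖u‖₂ > λ/ρ. -/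
/-- A point satisfying the first-order variational inequality on `[0, ∞)` minimizes the scalar
MCP-penalized least-squares objective. -/
theorem mcp_scalar_objective_le {ρ γ lam r s t : ℝ} (hρ : 0 < ρ) (hγ : 0 < γ) (hγρ : 1 < γ * ρ)
    (hlam : 0 ≤ lam) (hr : r ≤ γ * lam) (hs : s ≤ γ * lam)
    (hvar : ∀ t, 0 ≤ t → 0 ≤ (t - s) * (ρ * (s - r) + lam - s / γ)) (ht : 0 ≤ t) :
    ρ / 2 * (s - r) ^ 2 + (if s ≤ γ * lam then lam * s - s ^ 2 / (2 * γ) else γ * lam ^ 2 / 2) ≤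
      ρ / 2 * (t - r) ^ 2 +
        (if t ≤ γ * lam then lam * t - t ^ 2 / (2 * γ) else γ * lam ^ 2 / 2) := by
  have quad : ∀ t, 0 ≤ t → ρ / 2 * (s - r) ^ 2 + (lam * s - s ^ 2 / (2 * γ)) ≤
      ρ / 2 * (t - r) ^ 2 + (lam * t - t ^ 2 / (2 * γ)) := by
    intro t ht
    have hcurv : 0 ≤ ρ - 1 / γ := by
      rw [sub_nonneg, div_le_iff₀ hγ]
      linarith
    have hexp : ρ / 2 * (t - r) ^ 2 + (lam * t - t ^ 2 / (2 * γ)) -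
        (ρ / 2 * (s - r) ^ 2 + (lam * s - s ^ 2 / (2 * γ))) =
        (ρ - 1 / γ) / 2 * (t - s) ^ 2 + (t - s) * (ρ * (s - r) + lam - s / γ) := by
      field_simp
      ring
    have hsq : 0 ≤ (ρ - 1 / γ) / 2 * (t - s) ^ 2 := by positivity
    linarith [hvar t ht]
  rw [if_pos hs]
  split_ifs with h
  · exact quad t ht
  · push Not at h
    refine (quad (γ * lam) (by positivity)).trans ?_
    have hP : lam * (γ * lam) - (γ * lam) ^ 2 / (2 * γ) = γ * lam ^ 2 / 2 := by
      field_simp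
      ring
    rw [hP]
    gcongr

/-- Inner branch of the MCP δ-update: if γρ > 1, λ ≥ 0 and 0 < ‖u‖₂ ≤ γλ, then
δ* = S(u, λ/ρ)/(1 − 1/(γρ)) is a global minimizer of
δ ↦ (ρ/2)‖δ − u‖₂² + P_γ(‖δ‖₂, λ); explicitly δ* = 0 when ‖u‖₂ ≤ λ/ρ and
δ* = (1 − λ/(ρ‖u‖₂)) u / (1 − 1/(γρ)) when ‖u‖₂ > λ/ρ. -/
theorem stmt11 {d : ℕ} (hd : 1 ≤ d) (ρ γ lam : ℝ)
    (hρ : 0 < ρ) (hγ : 0 < γ) (hγρ : 1 < γ * ρ) (hlam : 0 ≤ lam)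
    (u : EuclideanSpace ℝ (Fin d)) (hu0 : 0 < ‖u‖) (hu : ‖u‖ ≤ γ * lam) :
    let P : ℝ → ℝ := fun t =>
      if t ≤ γ * lam then lam * t - t ^ 2 / (2 * γ) else γ * lam ^ 2 / 2
    let f : EuclideanSpace ℝ (Fin d) → ℝ := fun δ => (ρ / 2) * ‖δ - u‖ ^ 2 + P ‖δ‖
    let δstar : EuclideanSpace ℝ (Fin d) :=
      (1 - 1 / (γ * ρ))⁻¹ • (max (1 - (lam / ρ) / ‖u‖) 0 • u)
    (∀ δ : EuclideanSpace ℝ (Fin d), f δstar ≤ f δ) ∧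
    (‖u‖ ≤ lam / ρ → δstar = 0) ∧
    (lam / ρ < ‖u‖ →
      δstar = (1 - 1 / (γ * ρ))⁻¹ • ((1 - lam / (ρ * ‖u‖)) • u)) := by
  intro P f δstar
  have hk : 0 < 1 - 1 / (γ * ρ) := by
    rw [sub_pos, div_lt_one (by positivity)]
    exact hγρ
  refine ⟨fun δ => ?_, fun h => ?_, fun h => ?_⟩
  · set c : ℝ := (1 - 1 / (γ * ρ))⁻¹ * max (1 - (lam / ρ) / ‖u‖) 0 with hc
    have hc0 : 0 ≤ c := mul_nonneg (inv_nonneg.2 hk.le) (le_max_right _ _)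
    have hδ : δstar = c • u := smul_smul _ _ _
    have hnorm : ‖δstar‖ = c * ‖u‖ := by
      rw [hδ, norm_smul, Real.norm_of_nonneg hc0]
    have hdist : ‖δstar - u‖ ^ 2 = (c * ‖u‖ - ‖u‖) ^ 2 := by
      have : δstar - u = (c - 1) • u := by rw [hδ, sub_smul, one_smul]
      rw [this, norm_smul, mul_pow, Real.norm_eq_abs, sq_abs]
      ring
    have hkey : c * ‖u‖ ≤ γ * lam ∧
        ∀ t, 0 ≤ t → 0 ≤ (t - c * ‖u‖) * (ρ * (c * ‖u‖ - ‖u‖) + lam - c * ‖u‖ / γ) := by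
      rcases le_total ‖u‖ (lam / ρ) with h | h
      · have hcz : c = 0 := by
          rw [hc, max_eq_right (sub_nonpos.2 ((one_le_div hu0).2 h)), mul_zero]
        rw [hcz]
        refine ⟨by simpa using mul_nonneg hγ.le hlam, fun t ht => mul_nonneg (by simpa using ht) ?_⟩
        have := (le_div_iff₀ hρ).1 h
        simp only [zero_mul, zero_div]
        linarith
      · have hcr : c * ‖u‖ * (1 - 1 / (γ * ρ)) = ‖u‖ - lam / ρ := by
          rw [hc, max_eq_left (sub_nonneg.2 ((div_le_one hu0).2 h))]
          generalize 1 - 1 / (γ * ρ) = k at hk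
          field_simp
        constructor
        · refine le_of_mul_le_mul_right ?_ hk
          rw [hcr]
          have : γ * lam * (1 - 1 / (γ * ρ)) = γ * lam - lam / ρ := by field_simp
          linarith
        · intro t _
          have hz : ρ * (c * ‖u‖ - ‖u‖) + lam - c * ‖u‖ / γ =
              ρ * (c * ‖u‖ * (1 - 1 / (γ * ρ)) - (‖u‖ - lam / ρ)) := by
            field_simp
            ring
          rw [hz, hcr, sub_self, mul_zero, mul_zero]
    have hmin := mcp_scalar_objective_le hρ hγ hγρ hlam hu hkey.1 hkey.2 (norm_nonneg δ)
    have htri : (‖δ‖ - ‖u‖) ^ 2 ≤ ‖δ - u‖ ^ 2 :=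
      sq_le_sq.2 ((abs_norm_sub_norm_le δ u).trans (le_abs_self _))
    change ρ / 2 * ‖δstar - u‖ ^ 2 + P ‖δstar‖ ≤ ρ / 2 * ‖δ - u‖ ^ 2 + P ‖δ‖
    rw [hdist, hnorm]
    refine le_trans hmin ?_
    change ρ / 2 * (‖δ‖ - ‖u‖) ^ 2 + P ‖δ‖ ≤ _
    gcongr
  · simp only [δstar]
    rw [max_eq_right (sub_nonpos.2 ((one_le_div hu0).2 h)), zero_smul, smul_zero]
  · simp only [δstar]
    rw [max_eq_left (sub_nonneg.2 ((div_le_one hu0).2 h.le)), div_div]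
end
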